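/- For any phase P of the algorithm TC partitioned into the set of fields 𝓕 together with the open field F^∞, the cost of TC during P satisfies TC(P) ≤ 2α·size(𝓕) + req(F^∞) + k_P·α. -/

import Mathlib

open scoped Classical

/-!
Common setup for the online tree caching problem
(Bienkowski, Marcinkowski, Pacut, Schmid, Spyra, "Online Tree Caching").
-/

/-- A finite rooted tree on the vertex type `V`: every vertex has a parent,
the root is its own parent, and iterating `parent` from any vertex reaches the root. -/
structure RTree (V : Type) where
  root : V
  parent : V → V
  parent_root : parent root = root
  reaches_root : ∀ v : V, ∃ n : ℕ, parent^[n] v = root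

namespace RTree

variable {V : Type}

/-- The subtree `T(u)`: `u` together with all its descendants. -/
def subtree (T : RTree V) (u : V) : Set V :=
  {v | ∃ n : ℕ, T.parent^[n] v = u}

/-- `C` is a subforest of `T`: with every node it contains the whole subtree below it. -/
def Subforest (T : RTree V) (C : Set V) : Prop :=
  ∀ v ∈ C, T.subtree v ⊆ C

/-- `A` is a tree cap rooted at `v`: `A ⊆ T(v)`, `v ∈ A`, and `A` is closed under
taking the parent (towards `v`). -/
def TreeCap (T : RTree V) (v : V) (A : Set V) : Prop :=
  A ⊆ T.subtree v ∧ v ∈ A ∧ ∀ u ∈ A, u ≠ v → T.parent u ∈ A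

/-- `X` is a valid positive changeset for the cache `C`. -/
def ValidPos (T : RTree V) (C X : Set V) : Prop :=
  X.Nonempty ∧ X ∩ C = ∅ ∧ T.Subforest (C ∪ X)

/-- `X` is a valid negative changeset for the cache `C`. -/
def ValidNeg (T : RTree V) (C X : Set V) : Prop :=
  X.Nonempty ∧ X ⊆ C ∧ T.Subforest (C \ X)

/-- `X` is a valid changeset for the cache `C`. -/
def Valid (T : RTree V) (C X : Set V) : Prop :=
  T.ValidPos C X ∨ T.ValidNeg C X

/-- `w` is the root of a tree (connected component) of the subforest `C`. -/
def IsCompRoot (T : RTree V) (C : Set V) (w : V) : Prop :=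
  w ∈ C ∧ (w = T.root ∨ T.parent w ∉ C)

/-- The depth of a node: its distance to the root. -/
noncomputable def depth [DecidableEq V] (T : RTree V) (v : V) : ℕ :=
  Nat.find (T.reaches_root v)

/-- The height `h(T)` of the tree: its number of levels. -/
noncomputable def height [Fintype V] [DecidableEq V] (T : RTree V) : ℕ :=
  (Finset.univ.sup fun v => T.depth v) + 1

end RTree

/-- A request: a node together with a sign (`true` = positive, `false` = negative). -/
abbrev Request (V : Type) := V × Bool

/-- The request `r` incurs cost `1` when the cache is `C`
(a positive request to a non-cached node, or a negative request to a cached node). -/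
def Costly {V : Type} (r : Request V) (C : Set V) : Prop :=
  (r.2 = true ∧ r.1 ∉ C) ∨ (r.2 = false ∧ r.1 ∈ C)

/-- The sum of the counters `f` over the set of nodes `A`. -/
noncomputable def cntSum {V : Type} [Fintype V] (f : V → ℕ) (A : Set V) : ℕ :=
  ∑ v : V, A.indicator f v

/-- The number of nodes of a changeset (`0` for no changeset). -/
noncomputable def chgSize {V : Type} : Option (Set V) → ℕ
  | none => 0
  | some X => X.ncard

/-- One phase of the algorithm `TC` on the request sequence `req` (the request of
round `t ≥ 1` is `req t`), starting at time `0` with an empty cache.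
`cache t` is the cache contents during round `t`; `cnt t` are the counter values just
after serving the request of round `t` (used for the decision at time `t`);
`chg t` is the changeset applied at time `t` (right after round `t`), if any. -/
structure TCPhase {V : Type} [Fintype V] [DecidableEq V]
    (T : RTree V) (α : ℕ) (req : ℕ → Request V) where
  cache : ℕ → Set V
  cnt : ℕ → V → ℕ
  chg : ℕ → Option (Set V)
  cache_subforest : ∀ t, T.Subforest (cache t)
  cache_zero : cache 0 = ∅
  cnt_zero : ∀ v, cnt 0 v = 0
  cnt_rec : ∀ t v, cnt (t + 1) v =
    (if ∃ X, chg t = some X ∧ v ∈ X then 0 else cnt t v)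
    + (if (req (t + 1)).1 = v ∧ Costly (req (t + 1)) (cache (t + 1)) then 1 else 0)
  step_some : ∀ t X, chg t = some X →
    T.Valid (cache t) X ∧
    X.ncard * α ≤ cntSum (cnt t) X ∧
    (∀ Y, T.Valid (cache t) Y → X ⊂ Y → cntSum (cnt t) Y < Y.ncard * α) ∧
    cache (t + 1) = if T.ValidPos (cache t) X then cache t ∪ X else cache t \ X
  step_none : ∀ t, chg t = none →
    cache (t + 1) = cache t ∧
    ∀ X, T.Valid (cache t) X → cntSum (cnt t) X < X.ncard * α

namespace TCPhase

variable {V : Type} [Fintype V] [DecidableEq V]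
  {T : RTree V} {α : ℕ} {req : ℕ → Request V}

/-- The counter values at time `t`, right after the cache change at time `t`
(counters of fetched/evicted nodes are reset to `0`). -/
noncomputable def cntPost (E : TCPhase T α req) (t : ℕ) (v : V) : ℕ :=
  if ∃ X, E.chg t = some X ∧ v ∈ X then 0 else E.cnt t v

/-- `last_v(t)`: the last time strictly before `t` at which `v` changed its
cached/non-cached state (`0`, the beginning of the phase, if there is none). -/
noncomputable def lastChg (E : TCPhase T α req) (v : V) (t : ℕ) : ℕ :=
  ((Finset.range t).filter fun s => ¬ ((v ∈ E.cache s) ↔ v ∈ E.cache (s + 1))).sup id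

/-- The slot `(v, r)` belongs to the field `F^t`. -/
def inField (E : TCPhase T α req) (t : ℕ) (v : V) (r : ℕ) : Prop :=
  ∃ X, E.chg t = some X ∧ v ∈ X ∧ E.lastChg v t < r ∧ r ≤ t

/-- The number of requests of the sequence `ρ` lying in slots of `F^t_{≤ τ} ∩ D`. -/
noncomputable def fieldReqIn (E : TCPhase T α req) (ρ : ℕ → Request V)
    (t : ℕ) (D : Set V) (τ : ℕ) : ℕ :=
  ((Finset.Icc 1 t).filter fun r => r ≤ τ ∧ (ρ r).1 ∈ D ∧ E.inField t (ρ r).1 r).card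

/-- `req(F^t)`: the number of requests of `ρ` in slots of the field `F^t`. -/
noncomputable def fieldReq (E : TCPhase T α req) (ρ : ℕ → Request V) (t : ℕ) : ℕ :=
  E.fieldReqIn ρ t Set.univ t

/-- `size(F^t_{≤ τ} ∩ D)`: the number of distinct nodes having a slot in `F^t_{≤ τ} ∩ D`. -/
noncomputable def fieldSizeIn (E : TCPhase T α req) (t : ℕ) (D : Set V) (τ : ℕ) : ℕ :=
  (Finset.univ.filter fun v : V => v ∈ D ∧ ∃ r, r ≤ τ ∧ E.inField t v r).card

/-- The standing assumption: no positive requests are given to cached nodes and no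
negative requests to non-cached ones (so every request incurs cost `1` for `TC`). -/
def GoodReq (E : TCPhase T α req) : Prop :=
  ∀ t, 1 ≤ t →
    ((req t).2 = true → (req t).1 ∉ E.cache t) ∧
    ((req t).2 = false → (req t).1 ∈ E.cache t)

/-- The phase consists of rounds `1, …, tEnd`: no cache of `TC` before time `tEnd`
exceeds the capacity `kONL` (at time `tEnd` the triggered fetch, if any, is performed
even if it exceeds the capacity, and is followed by the final eviction). -/
def PhaseEnd (E : TCPhase T α req) (kONL tEnd : ℕ) : Prop :=
  ∀ t, t < tEnd → (E.cache (t + 1)).ncard ≤ kONL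

/-- `k_P`: the number of nodes in `TC`'s cache at the end of the phase
(after the fetch at time `tEnd`, before the final eviction). -/
noncomputable def kP (E : TCPhase T α req) (tEnd : ℕ) : ℕ :=
  (E.cache (tEnd + 1)).ncard

/-- The phase ending at `tEnd` is finished: the fetch at time `tEnd` exceeded the
capacity `kONL`. -/
def FinishedAt (E : TCPhase T α req) (kONL tEnd : ℕ) : Prop :=
  E.PhaseEnd kONL tEnd ∧ kONL < E.kP tEnd

/-- `size(𝓕)`: the total size of all fields of the phase. -/
noncomputable def sizeFields (E : TCPhase T α req) (tEnd : ℕ) : ℕ :=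
  ∑ t ∈ Finset.Icc 1 tEnd, chgSize (E.chg t)

/-- `req(F^∞)`: the number of requests of the phase lying in slots of the open field
(slots covered by no field of the phase). -/
noncomputable def openReq (E : TCPhase T α req) (tEnd : ℕ) : ℕ :=
  ((Finset.Icc 1 tEnd).filter fun r => ∀ t, t ≤ tEnd → ¬ E.inField t (req r).1 r).card

/-- `TC(P)`: the total cost paid by `TC` during the phase: serving the requests,
fetching/evicting the applied changesets (`α` per node), and the final eviction
(`α · k_P`) if the phase is finished. -/
noncomputable def tcCost (E : TCPhase T α req) (kONL tEnd : ℕ) : ℕ :=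
  ((Finset.Icc 1 tEnd).filter fun r => Costly (req r) (E.cache r)).card
  + α * E.sizeFields tEnd
  + (if kONL < E.kP tEnd then α * E.kP tEnd else 0)

/-- The tree cap `Y` (rooted at `u`, inside the negative field `F^t`) is proper for
the request sequence `ρ`: it holds `req(F^t ∩ Y) = |Y| · α`, and `F^t_{≤ τ} ∩ D` is
not over-requested for every tree cap `D ⊆ Y` rooted at `u` and every time `τ ≤ t`. -/
def Proper (E : TCPhase T α req) (ρ : ℕ → Request V) (t : ℕ) (u : V) (Y : Set V) : Prop :=
  E.fieldReqIn ρ t Y t = Y.ncard * α ∧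
  ∀ (D : Set V) (τ : ℕ), T.TreeCap u D → D ⊆ Y → τ ≤ t →
    E.fieldReqIn ρ t D τ ≤ E.fieldSizeIn t D τ * α

end TCPhase

/-- `D` is a feasible cache schedule for an (offline) algorithm with cache size `k`:
at every time the cache is a subforest of `T` of at most `k` nodes. -/
def IsSchedule {V : Type} (T : RTree V) (k : ℕ) (D : ℕ → Set V) : Prop :=
  ∀ t, T.Subforest (D t) ∧ (D t).ncard ≤ k

/-- The cost of serving the requests of rounds `a, …, b` of `ρ` when the cache during
round `r` is `D r`. -/
noncomputable def serveCost {V : Type} (ρ : ℕ → Request V) (D : ℕ → Set V) (a b : ℕ) : ℕ :=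
  ((Finset.Icc a b).filter fun r => Costly (ρ r) (D r)).card

/-- The reorganization cost of the schedule `D` (`α` per fetched or evicted node) over
the times `a, …, b - 1` (the change at time `t` leads from `D t` to `D (t+1)`). -/
noncomputable def moveCost {V : Type} (α : ℕ) (D : ℕ → Set V) (a b : ℕ) : ℕ :=
  α * ∑ t ∈ Finset.Ico a b, ((D (t + 1) \ D t).ncard + (D t \ D (t + 1)).ncard)

/-- `OPT`: the minimum cost of serving rounds `a, …, b` of `ρ` by an offline algorithm
with cache size `k` that may start with an arbitrary cache. -/
noncomputable def optCostFrom {V : Type} (T : RTree V) (α k : ℕ)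
    (ρ : ℕ → Request V) (a b : ℕ) : ℕ :=
  sInf {n | ∃ D : ℕ → Set V, IsSchedule T k D ∧
    n = serveCost ρ D a b + moveCost α D a b}

/-- `OPT`: the minimum cost of serving rounds `1, …, b` of `ρ` by an offline algorithm
with cache size `k` that starts with the empty cache. -/
noncomputable def optCostEmpty {V : Type} (T : RTree V) (α k : ℕ)
    (ρ : ℕ → Request V) (b : ℕ) : ℕ :=
  sInf {n | ∃ D : ℕ → Set V, IsSchedule T k D ∧ D 0 = ∅ ∧
    n = serveCost ρ D 1 b + moveCost α D 0 b}

/-- `ρ'` is obtained from `ρ` by legally shifting requests: signs are preserved, every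
positive request is moved to a descendant of its node (or kept), and every negative
request is moved to an ancestor of its node (or kept). -/
def LegalShift {V : Type} (T : RTree V) (ρ ρ' : ℕ → Request V) : Prop :=
  ∀ t, (ρ' t).2 = (ρ t).2 ∧
    ((ρ t).2 = true → (ρ' t).1 ∈ T.subtree (ρ t).1) ∧
    ((ρ t).2 = false → (ρ t).1 ∈ T.subtree (ρ' t).1)

/-- A full run of the algorithm `TC` with cache capacity `kONL` on the request
sequence `req`, including phase restarts: whenever the fetch of a saturated changeset
would exceed the capacity, `TC` instead evicts its whole cache and a new phase starts
(`newPhase t` holds, and all counters are reset). -/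
structure TCRun {V : Type} [Fintype V] [DecidableEq V]
    (T : RTree V) (α kONL : ℕ) (req : ℕ → Request V) where
  cache : ℕ → Set V
  cnt : ℕ → V → ℕ
  chg : ℕ → Option (Set V)
  newPhase : ℕ → Prop
  cache_subforest : ∀ t, T.Subforest (cache t)
  cache_zero : cache 0 = ∅
  cnt_zero : ∀ v, cnt 0 v = 0
  capacity : ∀ t, (cache t).ncard ≤ kONL
  cnt_rec : ∀ t v, cnt (t + 1) v =
    (if newPhase t ∨ ∃ X, chg t = some X ∧ v ∈ X then 0 else cnt t v)
    + (if (req (t + 1)).1 = v ∧ Costly (req (t + 1)) (cache (t + 1)) then 1 else 0)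
  step_some : ∀ t X, chg t = some X →
    T.Valid (cache t) X ∧
    X.ncard * α ≤ cntSum (cnt t) X ∧
    (∀ Y, T.Valid (cache t) Y → X ⊂ Y → cntSum (cnt t) Y < Y.ncard * α) ∧
    ((T.ValidPos (cache t) X ∧ (cache t ∪ X).ncard ≤ kONL ∧
        cache (t + 1) = cache t ∪ X ∧ ¬ newPhase t) ∨
     (T.ValidPos (cache t) X ∧ kONL < (cache t ∪ X).ncard ∧
        cache (t + 1) = ∅ ∧ newPhase t) ∨
     (T.ValidNeg (cache t) X ∧ cache (t + 1) = cache t \ X ∧ ¬ newPhase t))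
  step_none : ∀ t, chg t = none →
    cache (t + 1) = cache t ∧ ¬ newPhase t ∧
    ∀ X, T.Valid (cache t) X → cntSum (cnt t) X < X.ncard * α

/-- `TC(I)`: the total cost paid by the run `E` of `TC` on the rounds `1, …, N`:
serving the requests, plus `α` per fetched/evicted node (on a phase restart the whole
cache is evicted). -/
noncomputable def TCRun.cost {V : Type} [Fintype V] [DecidableEq V]
    {T : RTree V} {α kONL : ℕ} {req : ℕ → Request V}
    (E : TCRun T α kONL req) (N : ℕ) : ℕ :=
  ((Finset.Icc 1 N).filter fun r => Costly (req r) (E.cache r)).card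
  + α * ∑ t ∈ Finset.Icc 1 N,
      (if E.newPhase t then (E.cache t).ncard else chgSize (E.chg t))

namespace RTree

variable {V : Type} {T : RTree V} {A B : Set V}

lemma Subforest.union (hA : T.Subforest A) (hB : T.Subforest B) : T.Subforest (A ∪ B) := by
  rintro v (hv | hv)
  · exact (hA v hv).trans Set.subset_union_left
  · exact (hB v hv).trans Set.subset_union_right

lemma Subforest.inter (hA : T.Subforest A) (hB : T.Subforest B) : T.Subforest (A ∩ B) :=
  fun v hv => Set.subset_inter (hA v hv.1) (hB v hv.2)

lemma Valid.nonempty (h : T.Valid A B) : B.Nonempty := h.elim (·.1) (·.1)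

end RTree

section CounterSums

variable {V : Type} [Fintype V]

lemma cntSum_congr {f g : V → ℕ} {A B : Set V} (h : ∀ v, A.indicator f v = B.indicator g v) :
    cntSum f A = cntSum g B :=
  Finset.sum_congr rfl fun v _ => h v

lemma cntSum_union (f : V → ℕ) {A B : Set V} (h : Disjoint A B) :
    cntSum f (A ∪ B) = cntSum f A + cntSum f B := by
  simp only [cntSum, Set.indicator_union_of_disjoint h, Finset.sum_add_distrib]

lemma cntSum_eq_sum_filter (f : V → ℕ) (A : Set V) :
    cntSum f A = ∑ v ∈ Finset.univ.filter (· ∈ A), f v := by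
  simp only [cntSum, Finset.sum_filter, Set.indicator_apply]

end CounterSums

namespace TCPhase

variable {V : Type} [Fintype V] [DecidableEq V]
  {T : RTree V} {α : ℕ} {req : ℕ → Request V} (E : TCPhase T α req)

lemma cntSum_cntPost_of_some {t : ℕ} {X : Set V} (hX : E.chg t = some X) (Y : Set V) :
    cntSum (E.cntPost t) Y = cntSum (E.cnt t) (Y \ X) := by
  refine cntSum_congr fun v => ?_
  by_cases hY : v ∈ Y <;> by_cases hvX : v ∈ X <;> simp [cntPost, hX, hY, hvX]

lemma cntPost_of_none {t : ℕ} (h : E.chg t = none) : E.cntPost t = E.cnt t := by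
  funext v
  simp [cntPost, h]

lemma cnt_succ (t : ℕ) (v : V) : E.cnt (t + 1) v = E.cntPost t v +
    if (req (t + 1)).1 = v ∧ Costly (req (t + 1)) (E.cache (t + 1)) then 1 else 0 :=
  E.cnt_rec t v

lemma cntSum_cnt_succ_of_notMem {t : ℕ} {Y : Set V} (h : (req (t + 1)).1 ∉ Y) :
    cntSum (E.cnt (t + 1)) Y = cntSum (E.cntPost t) Y := by
  refine cntSum_congr fun v => ?_
  by_cases hY : v ∈ Y
  · have : (req (t + 1)).1 ≠ v := fun e => h (e ▸ hY)
    simp [hY, cnt_succ, this]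
  · simp [hY]

lemma cntSum_cnt_succ_le (t : ℕ) (Y : Set V) :
    cntSum (E.cnt (t + 1)) Y ≤ cntSum (E.cntPost t) Y + 1 := by
  have h : ∀ v, Y.indicator (E.cnt (t + 1)) v ≤
      Y.indicator (E.cntPost t) v + if (req (t + 1)).1 = v then 1 else 0 := by
    intro v
    by_cases hY : v ∈ Y
    · simp only [Set.indicator_of_mem hY, cnt_succ]
      split_ifs <;> grind
    · simp [hY]
  refine (Finset.sum_le_sum fun v _ => h v).trans ?_
  simp [Finset.sum_add_distrib, cntSum]

lemma chg_zero (hα : 1 ≤ α) : E.chg 0 = none := by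
  by_contra h
  obtain ⟨X, hX⟩ := Option.ne_none_iff_exists'.1 h
  obtain ⟨hv, hs, -⟩ := E.step_some 0 X hX
  have h0 : cntSum (E.cnt 0) X = 0 := by
    simp [cntSum_eq_sum_filter, E.cnt_zero]
  have := (Set.ncard_pos X.toFinite).2 hv.nonempty
  have := Nat.mul_pos this hα
  omega

/-- A changeset saturated by the request of round `t + 1` contains the requested node. -/
lemma req_mem_of_saturated {t : ℕ} {X : Set V}
    (h : cntSum (E.cntPost t) X < X.ncard * α)
    (hs : X.ncard * α ≤ cntSum (E.cnt (t + 1)) X) : (req (t + 1)).1 ∈ X := by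
  by_contra hv
  rw [E.cntSum_cnt_succ_of_notMem hv] at hs
  omega

/-- Applying a maximal saturated changeset `X` leaves no saturated set `Y` disjoint from `X`
for which `X ∪ Y` was a valid changeset. -/
lemma cntSum_lt_of_union_valid {t : ℕ} {X Y : Set V} (hX : E.chg t = some X)
    (hY : Y.Nonempty) (hd : Disjoint Y X) (hXY : T.Valid (E.cache t) (X ∪ Y)) :
    cntSum (E.cnt t) Y < Y.ncard * α := by
  obtain ⟨-, hs, hmax, -⟩ := E.step_some t X hX
  have hss : X ⊂ X ∪ Y := by
    refine Set.ssubset_iff_subset_ne.2 ⟨Set.subset_union_left, fun e => ?_⟩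
    obtain ⟨y, hy⟩ := hY
    exact Set.disjoint_left.1 hd hy (e ▸ Or.inr hy)
  have := hmax _ hXY hss
  rw [cntSum_union _ hd.symm, Set.ncard_union_eq hd.symm, add_mul] at this
  omega

/-- After each decision of `TC`, no valid changeset is saturated. -/
lemma cntSum_cntPost_lt (hα : 1 ≤ α) (t : ℕ) :
    ∀ Y, T.Valid (E.cache (t + 1)) Y → cntSum (E.cntPost t) Y < Y.ncard * α := by
  induction t with
  | zero =>
    have h0 := E.chg_zero hα
    rw [E.cntPost_of_none h0, (E.step_none 0 h0).1]
    exact (E.step_none 0 h0).2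
  | succ t ih =>
    cases hX : E.chg (t + 1) with
    | none =>
      rw [E.cntPost_of_none hX, (E.step_none _ hX).1]
      exact (E.step_none _ hX).2
    | some X =>
      intro Y hY
      obtain ⟨hv, hs, -, hc⟩ := E.step_some _ X hX
      have hreq := E.req_mem_of_saturated (ih X hv) hs
      have hYpos : 0 < Y.ncard * α :=
        Nat.mul_pos ((Set.ncard_pos Y.toFinite).2 hY.nonempty) hα
      rw [E.cntSum_cntPost_of_some hX]
      set C := E.cache (t + 1)
      have hC : T.Subforest C := E.cache_subforest (t + 1)
      have opposite (hval : (Y \ X).Nonempty → T.Valid C (Y \ X)) :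
          cntSum (E.cnt (t + 1)) (Y \ X) < Y.ncard * α := by
        rw [E.cntSum_cnt_succ_of_notMem fun h => h.2 hreq]
        rcases (Y \ X).eq_empty_or_nonempty with he | hne
        · simpa [he, cntSum] using hYpos
        · exact (ih _ (hval hne)).trans_le
            (Nat.mul_le_mul_right _ (Set.ncard_le_ncard Set.sdiff_subset Y.toFinite))
      have same (hd : Disjoint Y X) (hXY : T.Valid C (X ∪ Y)) :
          cntSum (E.cnt (t + 1)) (Y \ X) < Y.ncard * α := by
        rw [hd.sdiff_eq_left]
        exact E.cntSum_lt_of_union_valid hX hY.nonempty hd hXY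
      by_cases hp : T.ValidPos C X
      · rw [if_pos hp] at hc
        rw [hc] at hY
        obtain ⟨-, hXC, -⟩ := hp
        rw [← Set.disjoint_iff_inter_eq_empty] at hXC
        rcases hY with ⟨hne, hYC, hsub⟩ | ⟨-, hYC, hsub⟩
        · rw [← Set.disjoint_iff_inter_eq_empty, Set.disjoint_union_right] at hYC
          refine same hYC.2 (Or.inl ⟨hne.inr, ?_, ?_⟩)
          · exact Set.disjoint_iff_inter_eq_empty.1 (Set.disjoint_union_left.2 ⟨hXC, hYC.1⟩)
          · rwa [← Set.union_assoc]
        · refine opposite fun hn => Or.inr ⟨hn, ?_, ?_⟩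
          · rintro v ⟨hvY, hvX⟩
            exact (hYC hvY).resolve_right hvX
          · convert hC.inter hsub using 1
            ext v
            have : v ∈ X → v ∉ C := fun h => Set.disjoint_left.1 hXC h
            simp only [Set.mem_sdiff, Set.mem_inter_iff, Set.mem_union]
            tauto
      · obtain ⟨-, hXC, -⟩ := hv.resolve_left hp
        rw [if_neg hp] at hc
        rw [hc] at hY
        rcases hY with ⟨-, hYC, hsub⟩ | ⟨hne, hYC, hsub⟩
        · rw [← Set.disjoint_iff_inter_eq_empty] at hYC
          refine opposite fun hn => Or.inl ⟨hn, ?_, ?_⟩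
          · refine Set.disjoint_iff_inter_eq_empty.1 (Set.disjoint_left.2 fun v hv hvC => ?_)
            exact Set.disjoint_left.1 hYC hv.1 ⟨hvC, hv.2⟩
          · convert hC.union hsub using 1
            ext v
            have : v ∈ X → v ∈ C := fun h => hXC h
            simp only [Set.mem_sdiff, Set.mem_union]
            tauto
        · refine same (Set.disjoint_left.2 fun v hv => (hYC hv).2) (Or.inr ⟨hne.inr, ?_, ?_⟩)
          · exact Set.union_subset hXC (hYC.trans Set.sdiff_subset)
          · rwa [← Set.sdiff_sdiff]

/-- An applied changeset is saturated exactly, never over-saturated. -/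
lemma cntSum_cnt_le_of_chg (hα : 1 ≤ α) {t : ℕ} {X : Set V} (hX : E.chg t = some X) :
    cntSum (E.cnt t) X ≤ X.ncard * α := by
  cases t with
  | zero => simp [E.chg_zero hα] at hX
  | succ t =>
    have := E.cntSum_cntPost_lt hα t X (E.step_some _ X hX).1
    have := E.cntSum_cnt_succ_le t X
    omega

lemma cache_changes_iff (t : ℕ) (v : V) :
    ¬ (v ∈ E.cache t ↔ v ∈ E.cache (t + 1)) ↔ ∃ X, E.chg t = some X ∧ v ∈ X := by
  cases hX : E.chg t with
  | none => simp [(E.step_none t hX).1]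
  | some X =>
    obtain ⟨hv, -, -, hc⟩ := E.step_some t X hX
    by_cases hp : T.ValidPos (E.cache t) X
    · rw [if_pos hp] at hc
      have : v ∈ X → v ∉ E.cache t := fun h h' => by
        have : v ∈ X ∩ E.cache t := ⟨h, h'⟩
        rwa [hp.2.1] at this
      simp only [hc, Set.mem_union, Option.some.injEq, exists_eq_left']
      tauto
    · rw [if_neg hp] at hc
      have : v ∈ X → v ∈ E.cache t := fun h => (hv.resolve_left hp).2.1 h
      simp only [hc, Set.mem_sdiff, Option.some.injEq, exists_eq_left']
      tauto

lemma lastChg_le (v : V) (t : ℕ) : E.lastChg v t ≤ t :=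
  Finset.sup_le fun _ hs => (Finset.mem_range.1 (Finset.mem_filter.1 hs).1).le

lemma lastChg_succ (v : V) (t : ℕ) : E.lastChg v (t + 1) =
    if ∃ X, E.chg t = some X ∧ v ∈ X then t else E.lastChg v t := by
  have h := E.lastChg_le v t
  unfold lastChg at h ⊢
  rw [Finset.range_add_one, Finset.filter_insert]
  simp only [← E.cache_changes_iff]
  by_cases hc : v ∈ E.cache t ↔ v ∈ E.cache (t + 1)
  · rw [if_neg (not_not_intro hc), if_neg (not_not_intro hc)]
  · rw [if_pos hc, if_pos hc, Finset.sup_insert]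
    exact sup_eq_left.2 h

variable {E}

lemma GoodReq.costly (hgood : E.GoodReq) {t : ℕ} (ht : 1 ≤ t) :
    Costly (req t) (E.cache t) := by
  obtain ⟨h₁, h₂⟩ := hgood t ht
  cases h : (req t).2
  · exact Or.inr ⟨h, h₂ h⟩
  · exact Or.inl ⟨h, h₁ h⟩

/-- The counter of `v` is the number of requests at `v` since its last state change. -/
lemma GoodReq.cnt_eq (hgood : E.GoodReq) (t : ℕ) (v : V) :
    E.cnt t v = ((Finset.Ioc (E.lastChg v t) t).filter fun r => (req r).1 = v).card := by
  induction t with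
  | zero => simp [E.cnt_zero]
  | succ t ih =>
    have hlast : E.lastChg v (t + 1) ≤ t := by
      rw [lastChg_succ]
      split_ifs
      exacts [le_rfl, E.lastChg_le v t]
    have hpost : E.cntPost t v =
        ((Finset.Ioc (E.lastChg v (t + 1)) t).filter fun r => (req r).1 = v).card := by
      rw [lastChg_succ, cntPost]
      split_ifs
      · simp
      · exact ih
    rw [cnt_succ, hpost, ← Finset.insert_Ioc_right_eq_Ioc_add_one hlast, Finset.filter_insert]
    by_cases hv : (req (t + 1)).1 = v
    · rw [if_pos ⟨hv, hgood.costly t.succ_pos⟩, if_pos hv, Finset.card_insert_of_notMem]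
      simp
    · simp [hv]

lemma fieldReq_eq (E : TCPhase T α req) (ρ : ℕ → Request V) (t : ℕ) : E.fieldReq ρ t =
    ((Finset.Icc 1 t).filter fun r => E.inField t (ρ r).1 r).card := by
  unfold fieldReq fieldReqIn
  congr 1
  ext r
  simp only [Finset.mem_filter, Finset.mem_Icc, Set.mem_univ]
  tauto

lemma GoodReq.fieldReq_le (hgood : E.GoodReq) (hα : 1 ≤ α) (t : ℕ) :
    E.fieldReq req t ≤ chgSize (E.chg t) * α := by
  rw [fieldReq_eq]
  cases hX : E.chg t with
  | none => simp [inField, hX]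
  | some X =>
    refine le_trans ?_ (E.cntSum_cnt_le_of_chg hα hX)
    rw [cntSum_eq_sum_filter]
    simp only [hgood.cnt_eq]
    refine le_trans (Finset.card_le_card fun r hr => ?_) Finset.card_biUnion_le
    obtain ⟨-, Z, hZ, hrZ, hlt, hle⟩ := Finset.mem_filter.1 hr
    obtain rfl : X = Z := Option.some.inj (hX.symm.trans hZ)
    simpa using ⟨hrZ, hlt, hle⟩

/-- Every request of the phase lies in the open field or in one of the other fields. -/
lemma le_sum_fieldReq_add_openReq (E : TCPhase T α req) (tEnd : ℕ) :
    tEnd ≤ ∑ t ∈ Finset.Icc 1 tEnd, E.fieldReq req t + E.openReq tEnd := by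
  have hcover : Finset.Icc 1 tEnd ⊆
      ((Finset.Icc 1 tEnd).biUnion fun t => (Finset.Icc 1 t).filter fun r =>
        E.inField t (req r).1 r) ∪
      (Finset.Icc 1 tEnd).filter fun r => ∀ t, t ≤ tEnd → ¬ E.inField t (req r).1 r := by
    intro r hr
    by_cases h : ∀ t, t ≤ tEnd → ¬ E.inField t (req r).1 r
    · exact Finset.mem_union_right _ (Finset.mem_filter.2 ⟨hr, h⟩)
    · push Not at h
      obtain ⟨t, ht, hf⟩ := h
      obtain ⟨-, -, -, -, hrt⟩ := id hf
      have hr1 := (Finset.mem_Icc.1 hr).1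
      refine Finset.mem_union_left _ (Finset.mem_biUnion.2 ⟨t, ?_, Finset.mem_filter.2 ?_⟩)
      · exact Finset.mem_Icc.2 ⟨hr1.trans hrt, ht⟩
      · exact ⟨Finset.mem_Icc.2 ⟨hr1, hrt⟩, hf⟩
  have := Finset.card_le_card hcover
  simp only [fieldReq_eq]
  rw [Nat.card_Icc, Nat.add_sub_cancel] at this
  exact this.trans ((Finset.card_union_le _ _).trans
    (Nat.add_le_add_right Finset.card_biUnion_le _))

end TCPhase

/-- for any phase `P` of `TC` partitioned into the fields `𝓕` and the
open field `F^∞`, it holds `TC(P) ≤ 2α·size(𝓕) + req(F^∞) + k_P·α`. -/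
theorem tc_cost_bound {V : Type} [Fintype V] [DecidableEq V]
    {T : RTree V} {α : ℕ} {req : ℕ → Request V}
    (E : TCPhase T α req) (hα : 1 ≤ α) (hgood : E.GoodReq)
    (kONL tEnd : ℕ) (hend : E.PhaseEnd kONL tEnd) :
    E.tcCost kONL tEnd ≤
      2 * α * E.sizeFields tEnd + E.openReq tEnd + E.kP tEnd * α := by
  have hserve : ((Finset.Icc 1 tEnd).filter fun r => Costly (req r) (E.cache r)).card ≤ tEnd :=
    (Finset.card_filter_le _ _).trans (by simp)
  have hopen := E.le_sum_fieldReq_add_openReq tEnd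
  have hfields : ∑ t ∈ Finset.Icc 1 tEnd, E.fieldReq req t ≤ α * E.sizeFields tEnd := by
    rw [TCPhase.sizeFields, mul_comm, Finset.sum_mul]
    exact Finset.sum_le_sum fun t _ => hgood.fieldReq_le hα t
  have hevict : (if kONL < E.kP tEnd then α * E.kP tEnd else 0) ≤ E.kP tEnd * α := by
    split_ifs
    · rw [mul_comm]
    · exact Nat.zero_le _
  rw [TCPhase.tcCost, mul_assoc]
  omega
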